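/- Let H be a subgroup of a countably infinite discrete group G with [G:H] < +∞, let (X,H,α) be a topological dynamical system, and let (X_H^G, G, α^{H\G}) be the co-induced system. Then (X_H^G, G, α^{H\G}) is null if and only if (X,H,α) is null. -/

import Mathlib

open Filter Topology Set
open scoped ENNReal Classical

section EntropyDefs

variable {G X : Type*}

/-- `𝒰` is an open cover of `X`. -/
def IsOpenCover [TopologicalSpace X] (𝒰 : Set (Set X)) : Prop :=
  (∀ U ∈ 𝒰, IsOpen U) ∧ ⋃₀ 𝒰 = Set.univ

/-- `N(𝒰)`: the minimal cardinality of a finite subcover of `𝒰`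
(junk value `0` if no finite subcover exists). -/
noncomputable def coverN (𝒰 : Set (Set X)) : ℕ :=
  sInf {n : ℕ | ∃ F : Finset (Set X), ↑F ⊆ 𝒰 ∧ F.card = n ∧ ⋃₀ (F : Set (Set X)) = Set.univ}

/-- The join `⋁_{i=1}^n α_{g_i⁻¹}(𝒰)` of the covers `α_{g_i⁻¹}(𝒰) = (α g_i)⁻¹'(𝒰)`. -/
def joinPull (α : G → X → X) (𝒰 : Set (Set X)) {n : ℕ} (g : Fin n → G) : Set (Set X) :=
  {V | ∃ U : Fin n → Set X, (∀ i, U i ∈ 𝒰) ∧ V = ⋂ i, α (g i) ⁻¹' U i}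

/-- Topological sequence entropy of the cover `𝒰` along the sequence `𝔰`:
`h_top^𝔰(𝒰,G) = limsup_n (1/n) log N(⋁_{i=1}^n α_{𝔰(i)⁻¹}(𝒰))`, valued in `[0,∞]`. -/
noncomputable def seqEntCover (α : G → X → X) (𝔰 : ℕ → G) (𝒰 : Set (Set X)) : ℝ≥0∞ :=
  Filter.atTop.limsup fun n : ℕ =>
    ENNReal.ofReal (Real.log (coverN (joinPull α 𝒰 fun i : Fin n => 𝔰 i)) / n)

/-- Topological sequence entropy of the action along `𝔰`: supremum over all open covers. -/
noncomputable def seqEnt [TopologicalSpace X] (α : G → X → X) (𝔰 : ℕ → G) : ℝ≥0∞ :=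
  ⨆ 𝒰 ∈ {𝒰 : Set (Set X) | IsOpenCover 𝒰}, seqEntCover α 𝔰 𝒰

/-- `p*_{X,G,𝒰}(n) = max_{(g_1,…,g_n) ∈ Gⁿ} N(⋁_{i=1}^n α_{g_i⁻¹}(𝒰))`. -/
noncomputable def patN (α : G → X → X) (𝒰 : Set (Set X)) (n : ℕ) : ℕ :=
  sSup {m : ℕ | ∃ g : Fin n → G, m = coverN (joinPull α 𝒰 g)}

/-- Maximal pattern entropy of the cover `𝒰`: `lim_n (1/n) log p*_{X,G,𝒰}(n)`
(the limit exists by subadditivity and coincides with the limsup used here). -/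
noncomputable def patEntCover (α : G → X → X) (𝒰 : Set (Set X)) : ℝ≥0∞ :=
  Filter.atTop.limsup fun n : ℕ => ENNReal.ofReal (Real.log (patN α 𝒰 n) / n)

/-- Maximal pattern entropy `h*_top(X,G)`: supremum over all open covers. -/
noncomputable def patEnt [TopologicalSpace X] (α : G → X → X) : ℝ≥0∞ :=
  ⨆ 𝒰 ∈ {𝒰 : Set (Set X) | IsOpenCover 𝒰}, patEntCover α 𝒰

/-- `α` is an action of `G` on `X` by homeomorphisms. -/
def IsActionBy [Group G] [TopologicalSpace X] (α : G → X → X) : Prop :=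
  (∀ x, α 1 x = x) ∧ (∀ g h x, α (g * h) x = α g (α h x)) ∧ ∀ g, Continuous (α g)

/-- `I ⊆ G` is an independence set for the tuple `(A 1, …, A k)`:
for every nonempty finite `F ⊆ I` and every `ω : F → {1,…,k}` we have
`⋂_{g ∈ F} α_{g⁻¹}(A (ω g)) ≠ ∅`. -/
def IsIndepSet (α : G → X → X) {k : ℕ} (A : Fin k → Set X) (I : Set G) : Prop :=
  ∀ F : Finset G, ↑F ⊆ I → F.Nonempty → ∀ ω : G → Fin k,
    (⋂ g ∈ F, α g ⁻¹' A (ω g)).Nonempty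

/-- The tuple `(A 1, …, A k)` has arbitrarily large finite independence sets. -/
def HasArbLargeIndep (α : G → X → X) {k : ℕ} (A : Fin k → Set X) : Prop :=
  ∀ n : ℕ, ∃ F : Finset G, n ≤ F.card ∧ IsIndepSet α A ↑F

/-- `(x 1, …, x k)` is an IN-tuple: every product neighbourhood has arbitrarily large
finite independence sets. -/
def IsINTuple [TopologicalSpace X] (α : G → X → X) {k : ℕ} (x : Fin k → X) : Prop :=
  ∀ U : Fin k → Set X, (∀ i, IsOpen (U i)) → (∀ i, x i ∈ U i) → HasArbLargeIndep α U

/-- The action `α` of `G` on `X` is (topologically) weak-mixing. -/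
def IsWeakMixing [TopologicalSpace X] (α : G → X → X) : Prop :=
  ∀ U₁ U₂ V₁ V₂ : Set X, IsOpen U₁ → IsOpen U₂ → IsOpen V₁ → IsOpen V₂ →
    U₁.Nonempty → U₂.Nonempty → V₁.Nonempty → V₂.Nonempty →
    ∃ g : G, (U₁ ∩ α g '' V₁).Nonempty ∧ (U₂ ∩ α g '' V₂).Nonempty

/-- `(x₁,x₂)` is a sequence entropy pair. -/
def IsSeqEntropyPair [TopologicalSpace X] (α : G → X → X) (x₁ x₂ : X) : Prop :=
  x₁ ≠ x₂ ∧ ∀ A₁ A₂ : Set X, IsClosed A₁ → IsClosed A₂ →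
    A₁ ∈ nhds x₁ → A₂ ∈ nhds x₂ → Disjoint A₁ A₂ →
    ∃ 𝔰 : ℕ → G, 0 < seqEntCover α 𝔰 {A₁ᶜ, A₂ᶜ}

/-- `(x 1, …, x k)` is a sequence entropy tuple: it is not diagonal, and whenever
`U i` are closed neighbourhoods of the `x i` which coincide on equal coordinates and are
pairwise disjoint on distinct coordinates (i.e. pairwise disjoint closed neighbourhoods of
the distinct points of the tuple), some sequence gives positive sequence entropy for the
cover by their complements. -/
def IsSeqEntropyTuple [TopologicalSpace X] (α : G → X → X) {k : ℕ} (x : Fin k → X) : Prop :=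
  (∃ i j, x i ≠ x j) ∧ ∀ U : Fin k → Set X,
    (∀ i, IsClosed (U i)) → (∀ i, U i ∈ nhds (x i)) →
    (∀ i j, x i = x j → U i = U j) → (∀ i j, x i ≠ x j → Disjoint (U i) (U j)) →
    ∃ 𝔰 : ℕ → G, 0 < seqEntCover α 𝔰 (Set.range fun i => (U i)ᶜ)

end EntropyDefs

namespace CoInd

variable {G : Type*} [Group G] (H : Subgroup G)

/-- `H\G`, the space of right cosets of `H` in `G`. -/
abbrev RQ := Quotient (QuotientGroup.rightRel H)

/-- Right multiplication `Hg ↦ H(g·g₀)` on the right coset space. -/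
def rmul (g₀ : G) : RQ H → RQ H :=
  Quotient.map' (fun g => g * g₀) (fun a b hab => by
    rw [QuotientGroup.rightRel_apply] at hab ⊢
    have h2 : b * g₀ * (a * g₀)⁻¹ = b * a⁻¹ := by group
    rw [h2]; exact hab)

/-- `s : H\G → G` is a section of the right cosets with `s(H) = e`. -/
def IsSection (s : RQ H → G) : Prop :=
  (∀ θ : RQ H, Quotient.mk'' (s θ) = θ) ∧ s (Quotient.mk'' 1) = 1

variable {X : Type*}

/-- The co-induced action `α^{H\G}` of `G` on `X_H^G = ∏_{θ ∈ H\G} X`, relative to a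
section `s` of the right cosets:
`(α^{H\G}_{g₀} f)(Hg) = α_{s(Hg)·g₀·s(Hg·g₀)⁻¹} (f (Hg·g₀))`.
(When `s` is a genuine section the element `s(Hg)·g₀·s(Hg·g₀)⁻¹` always lies in `H`,
so the `else` branch is never taken.) -/
noncomputable def coindAct (α : ↥H → X → X) (s : RQ H → G) (g₀ : G)
    (f : RQ H → X) : RQ H → X := fun θ =>
  if h : s θ * g₀ * (s (rmul H g₀ θ))⁻¹ ∈ H then
    α ⟨s θ * g₀ * (s (rmul H g₀ θ))⁻¹, h⟩ (f (rmul H g₀ θ))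
  else f (rmul H g₀ θ)

end CoInd

section CoverNumber

variable {X Y G : Type*}

/-- A finite family covering the space and refining `𝒰` bounds `coverN 𝒰`. -/
theorem coverN_le_card_of_refines {ι : Type*} [Fintype ι] {𝒰 : Set (Set X)} (f : ι → Set X)
    (hf : ∀ i, ∃ U ∈ 𝒰, f i ⊆ U) (hcov : ∀ x, ∃ i, x ∈ f i) :
    coverN 𝒰 ≤ Fintype.card ι := by
  choose u hu hfu using hf
  refine le_trans (Nat.sInf_le ?_) (Finset.card_image_le (s := Finset.univ) (f := u))
  refine ⟨Finset.univ.image u, ?_, rfl, ?_⟩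
  · intro V hV
    obtain ⟨i, -, rfl⟩ := Finset.mem_image.1 (Finset.mem_coe.1 hV)
    exact hu i
  · refine Set.eq_univ_of_forall fun x => ?_
    obtain ⟨i, hi⟩ := hcov x
    exact ⟨u i, Finset.mem_coe.2 (Finset.mem_image_of_mem u (Finset.mem_univ i)), hfu i hi⟩

/-- On a compact space the minimal cardinality of a subcover of an open cover is attained. -/
theorem IsOpenCover.exists_card_eq_coverN [TopologicalSpace X] [CompactSpace X]
    {𝒰 : Set (Set X)} (h : IsOpenCover 𝒰) :
    ∃ F : Finset (Set X), ↑F ⊆ 𝒰 ∧ F.card = coverN 𝒰 ∧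
      ⋃₀ (F : Set (Set X)) = Set.univ := by
  obtain ⟨T, hT, hfin, hcov⟩ := isCompact_univ.elim_finite_subcover_image (c := id) h.1
    (by simpa [← Set.sUnion_eq_biUnion] using h.2.ge)
  refine Nat.sInf_mem (s := {n : ℕ | ∃ F : Finset (Set X), ↑F ⊆ 𝒰 ∧ F.card = n ∧
    ⋃₀ (F : Set (Set X)) = Set.univ}) ⟨_, hfin.toFinset, ?_, rfl, ?_⟩
  · simpa using hT
  · simpa [Set.sUnion_eq_biUnion] using Set.univ_subset_iff.1 hcov

theorem IsOpenCover.joinPull [TopologicalSpace X] {α : G → X → X} (hα : ∀ g, Continuous (α g))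
    {𝒰 : Set (Set X)} (h : IsOpenCover 𝒰) {n : ℕ} (g : Fin n → G) :
    IsOpenCover (joinPull α 𝒰 g) := by
  constructor
  · rintro _ ⟨U, hU, rfl⟩
    exact isOpen_iInter_of_finite fun i => (h.1 _ (hU i)).preimage (hα _)
  · refine Set.eq_univ_of_forall fun x => ?_
    have hx : ∀ i, ∃ U ∈ 𝒰, α (g i) x ∈ U := fun i => Set.mem_sUnion.1 (h.2 ▸ Set.mem_univ _)
    choose U hU hxU using hx
    exact ⟨_, ⟨U, hU, rfl⟩, Set.mem_iInter.2 hxU⟩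

theorem IsOpenCover.image_preimage [TopologicalSpace X] [TopologicalSpace Y] {π : Y → X}
    (hπ : Continuous π) {𝒰 : Set (Set X)} (h : IsOpenCover 𝒰) :
    IsOpenCover (Set.preimage π '' 𝒰) := by
  constructor
  · rintro _ ⟨U, hU, rfl⟩
    exact (h.1 U hU).preimage hπ
  · rw [Set.sUnion_image, ← Set.preimage_sUnion, h.2, Set.preimage_univ]

theorem IsOpenCover.coverN_le_image_preimage [TopologicalSpace X] [TopologicalSpace Y]
    [CompactSpace Y] {π : Y → X} (hπ : Continuous π) (hsurj : Function.Surjective π)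
    {𝒰 : Set (Set X)} (h : IsOpenCover 𝒰) :
    coverN 𝒰 ≤ coverN (Set.preimage π '' 𝒰) := by
  obtain ⟨F, hF, hcard, hcov⟩ := (h.image_preimage hπ).exists_card_eq_coverN
  rw [← hcard, ← Fintype.card_coe]
  choose W hW hWF using fun V : F => hF V.2
  refine coverN_le_card_of_refines W (fun V => ⟨W V, hW V, subset_rfl⟩) fun x => ?_
  obtain ⟨y, rfl⟩ := hsurj x
  obtain ⟨V, hV, hy⟩ := Set.mem_sUnion.1 (hcov ▸ Set.mem_univ y)
  refine ⟨⟨V, hV⟩, ?_⟩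
  change y ∈ π ⁻¹' W ⟨V, hV⟩
  rwa [hWF]

theorem joinPull_image_preimage {K : Type*} {α : G → X → X} {β : K → Y → Y} {π : Y → X}
    {n : ℕ} {g : Fin n → G} {k : Fin n → K}
    (hπ : ∀ i y, π (β (k i) y) = α (g i) (π y)) (𝒰 : Set (Set X)) :
    joinPull β (Set.preimage π '' 𝒰) k = Set.preimage π '' joinPull α 𝒰 g := by
  have key : ∀ U : Fin n → Set X,
      ⋂ i, β (k i) ⁻¹' (π ⁻¹' U i) = π ⁻¹' ⋂ i, α (g i) ⁻¹' U i := by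
    intro U
    ext y
    simp [hπ]
  ext V
  constructor
  · rintro ⟨U, hU, rfl⟩
    choose W hW hWU using hU
    refine ⟨_, ⟨W, hW, rfl⟩, ?_⟩
    rw [← key]
    simp only [hWU]
  · rintro ⟨_, ⟨U, hU, rfl⟩, rfl⟩
    exact ⟨fun i => π ⁻¹' U i, fun i => ⟨U i, hU i, rfl⟩, (key U).symm⟩

theorem isOpenCover_range_ball [PseudoMetricSpace X] {δ : ℝ} (hδ : 0 < δ) :
    IsOpenCover (Set.range fun x : X => Metric.ball x δ) := by
  constructor
  · rintro _ ⟨x, rfl⟩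
    exact Metric.isOpen_ball
  · exact Set.eq_univ_of_forall fun x => ⟨_, ⟨x, rfl⟩, Metric.mem_ball_self hδ⟩

theorem seqEnt_eq_zero_iff [TopologicalSpace X] {α : G → X → X} {𝔰 : ℕ → G} :
    seqEnt α 𝔰 = 0 ↔ ∀ 𝒰 : Set (Set X), IsOpenCover 𝒰 →
      Tendsto (fun n : ℕ => ENNReal.ofReal
        (Real.log (coverN (joinPull α 𝒰 fun i : Fin n => 𝔰 i)) / n)) atTop (𝓝 0) := by
  simp only [seqEnt, ENNReal.iSup_eq_zero, Set.mem_ofPred_eq]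
  refine forall₂_congr fun 𝒰 _ => ⟨fun h => ?_, fun h => h.limsup_eq⟩
  exact tendsto_of_le_liminf_of_limsup_le bot_le h.le

end CoverNumber

namespace CoInd

variable {G : Type*} [Group G] {H : Subgroup G} {X : Type*}

theorem finite_RQ (hH : H.index ≠ 0) : Finite (RQ H) :=
  have : Finite (G ⧸ H) := Nat.finite_of_card_ne_zero hH
  Finite.of_equiv _ (QuotientGroup.quotientRightRelEquivQuotientLeftRel H).symm

theorem IsSection.mul_mem {s : RQ H → G} (hs : IsSection H s) (g : G) (θ : RQ H) :
    s θ * g * (s (rmul H g θ))⁻¹ ∈ H := by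
  rw [← QuotientGroup.rightRel_apply]
  refine Quotient.exact (s := QuotientGroup.rightRel H) ((hs.1 _).trans ?_)
  conv_lhs => rw [← hs.1 θ]
  rfl

/-- The `H`-valued cocycle `(g, θ) ↦ s(θ) g s(θ g)⁻¹` of a section of the right cosets. -/
def IsSection.cocycle {s : RQ H → G} (hs : IsSection H s) (g : G) (θ : RQ H) : H :=
  ⟨s θ * g * (s (rmul H g θ))⁻¹, hs.mul_mem g θ⟩

theorem IsSection.coindAct_apply {s : RQ H → G} (hs : IsSection H s) (α : H → X → X) (g : G)
    (f : RQ H → X) (θ : RQ H) :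
    coindAct H α s g f θ = α (hs.cocycle g θ) (f (rmul H g θ)) :=
  dif_pos (hs.mul_mem g θ)

theorem rmul_coe_one (h : H) : rmul H (h : G) (Quotient.mk'' 1) = Quotient.mk'' 1 := by
  refine Quotient.sound (s := QuotientGroup.rightRel H) ?_
  change QuotientGroup.rightRel H _ _
  rw [QuotientGroup.rightRel_apply]
  simp

theorem IsSection.coindAct_coe_apply_one {s : RQ H → G} (hs : IsSection H s) (α : H → X → X)
    (h : H) (f : RQ H → X) :
    coindAct H α s h f (Quotient.mk'' 1) = α h (f (Quotient.mk'' 1)) := by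
  rw [hs.coindAct_apply, rmul_coe_one]
  congr
  ext
  simp [IsSection.cocycle, rmul_coe_one, hs.2]

/-- Nullness passes from the co-induced system to the original one, along the projection to the
coordinate of the trivial coset. -/
theorem seqEnt_eq_zero_of_coindAct [TopologicalSpace X] [CompactSpace X] {α : H → X → X}
    (hα : ∀ h, Continuous (α h)) {s : RQ H → G} (hs : IsSection H s) {𝔱 : ℕ → H}
    (h : seqEnt (coindAct H α s) (fun n => (𝔱 n : G)) = 0) : seqEnt α 𝔱 = 0 := by
  rw [seqEnt_eq_zero_iff] at h ⊢
  intro 𝒰 h𝒰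
  let π : (RQ H → X) → X := fun f => f (Quotient.mk'' 1)
  have hπ : Continuous π := continuous_apply _
  refine tendsto_of_tendsto_of_tendsto_of_le_of_le tendsto_const_nhds
    (h _ (h𝒰.image_preimage hπ)) (fun _ => zero_le) fun n => ?_
  have hle := (h𝒰.joinPull hα fun i : Fin n => 𝔱 i).coverN_le_image_preimage hπ
    fun x => ⟨fun _ => x, rfl⟩
  rw [← joinPull_image_preimage (β := coindAct H α s) (k := fun i : Fin n => (𝔱 i : G))
    fun i f => hs.coindAct_coe_apply_one α (𝔱 i) f] at hle
  refine ENNReal.ofReal_le_ofReal (div_le_div_of_nonneg_right ?_ n.cast_nonneg)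
  rcases Nat.eq_zero_or_pos (coverN (joinPull α 𝒰 fun i : Fin n => 𝔱 i)) with h0 | h0
  · simpa [h0] using Real.log_natCast_nonneg _
  · exact Real.log_le_log (by exact_mod_cast h0) (by exact_mod_cast hle)

/-- If `δ` is a Lebesgue number of the cover `𝒰` of the product, the covering numbers of the
co-induced action are controlled by those of the cover of `X` by `δ`-balls along the cocycles. -/
theorem coverN_joinPull_coindAct_le [PseudoMetricSpace X] [CompactSpace X] [Fintype (RQ H)]
    {α : H → X → X} (hα : ∀ h, Continuous (α h)) {s : RQ H → G} (hs : IsSection H s)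
    {𝒰 : Set (Set (RQ H → X))} {δ : ℝ} (hδ : 0 < δ)
    (h𝒰 : ∀ f : RQ H → X, ∃ U ∈ 𝒰, Metric.ball f δ ⊆ U) {n : ℕ} (g : Fin n → G) :
    coverN (joinPull (coindAct H α s) 𝒰 g) ≤
      (∏ θ, coverN (joinPull α (Set.range fun x : X => Metric.ball x δ)
        fun i => hs.cocycle (g i) θ)) ^ Fintype.card (RQ H) := by
  choose F hF hcard hcov using fun θ => ((isOpenCover_range_ball (X := X) hδ).joinPull hα
    fun i => hs.cocycle (g i) θ).exists_card_eq_coverN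
  have hcount : Fintype.card (RQ H → ∀ θ, F θ) = (∏ θ, coverN (joinPull α
      (Set.range fun x : X => Metric.ball x δ) fun i => hs.cocycle (g i) θ)) ^
        Fintype.card (RQ H) := by
    simp [Fintype.card_pi, hcard]
  rw [← hcount]
  refine coverN_le_card_of_refines
    (fun c : RQ H → ∀ θ, F θ => {f | ∀ θ' θ, f θ' ∈ (c θ' θ : Set X)}) (fun c => ?_) fun f => ?_
  · choose V hV hcV using fun θ' θ => hF θ (c θ' θ).2
    choose x hx using hV
    choose U hU hxU using fun i => h𝒰 fun θ => x (rmul H (g i) θ) θ i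
    refine ⟨_, ⟨U, hU, rfl⟩, fun f hf => Set.mem_iInter.2 fun i => hxU i ?_⟩
    rw [ball_pi _ hδ]
    intro θ _
    have hmem := hf (rmul H (g i) θ) θ
    rw [hcV] at hmem
    have hi := Set.mem_iInter.1 hmem i
    rw [← hx] at hi
    rw [hs.coindAct_apply]
    exact hi
  · have hf : ∀ θ' θ, ∃ V : F θ, f θ' ∈ (V : Set X) := fun θ' θ => by
      obtain ⟨V, hV, hm⟩ := Set.mem_sUnion.1 (hcov θ ▸ Set.mem_univ (f θ'))
      exact ⟨⟨V, hV⟩, hm⟩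
    choose c hc using hf
    exact ⟨c, hc⟩

theorem seqEnt_coindAct_eq_zero [PseudoMetricSpace X] [CompactSpace X] [Finite (RQ H)]
    {α : H → X → X} (hα : ∀ h, Continuous (α h)) {s : RQ H → G} (hs : IsSection H s)
    {𝔰 : ℕ → G} (h : ∀ θ, seqEnt α (fun n => hs.cocycle (𝔰 n) θ) = 0) :
    seqEnt (coindAct H α s) 𝔰 = 0 := by
  have := Fintype.ofFinite (RQ H)
  simp only [seqEnt_eq_zero_iff] at h ⊢
  intro 𝒰 h𝒰
  obtain ⟨δ, hδ, hball⟩ := lebesgue_number_lemma_of_metric_sUnion isCompact_univ h𝒰.1 h𝒰.2.ge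
  have hlim := ENNReal.Tendsto.const_mul (a := (Fintype.card (RQ H) : ℝ≥0∞))
    (tendsto_finsetSum Finset.univ fun θ _ => h θ _ (isOpenCover_range_ball (X := X) hδ))
    (Or.inr (ENNReal.natCast_ne_top _))
  rw [Finset.sum_const_zero, mul_zero] at hlim
  refine tendsto_of_tendsto_of_tendsto_of_le_of_le tendsto_const_nhds hlim
    (fun _ => zero_le) fun n => ?_
  have hle := coverN_joinPull_coindAct_le hα hs hδ (fun f => hball f (Set.mem_univ f))
    fun i : Fin n => 𝔰 i
  have hnonneg : ∀ m : ℕ, 0 ≤ Real.log m / n := fun m =>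
    div_nonneg (Real.log_natCast_nonneg m) n.cast_nonneg
  dsimp only
  rw [← ENNReal.ofReal_sum_of_nonneg fun θ _ => hnonneg _, ← ENNReal.ofReal_natCast,
    ← ENNReal.ofReal_mul (Nat.cast_nonneg _)]
  refine ENNReal.ofReal_le_ofReal ?_
  rcases Nat.eq_zero_or_pos
    (coverN (joinPull (coindAct H α s) 𝒰 fun i : Fin n => 𝔰 i)) with h0 | h0
  · rw [h0, Nat.cast_zero, Real.log_zero, zero_div]
    exact mul_nonneg (Nat.cast_nonneg _) (Finset.sum_nonneg fun θ _ => hnonneg _)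
  · have hpow := h0.trans_le hle
    have hprod := Nat.pos_of_ne_zero (pow_ne_zero_iff (Fintype.card_pos_iff.2
      ⟨(Quotient.mk'' 1 : RQ H)⟩).ne' |>.1 hpow.ne')
    rw [← Finset.sum_div, ← mul_div_assoc]
    refine div_le_div_of_nonneg_right ?_ n.cast_nonneg
    rw [← Real.log_prod fun θ _ => Nat.cast_ne_zero.2
      (Finset.prod_ne_zero_iff.1 hprod.ne' θ (Finset.mem_univ θ)), ← Real.log_pow]
    exact Real.log_le_log (by exact_mod_cast h0) (by exact_mod_cast hle)

end CoInd

/-- Theorem 3.3: for `[G:H] < ∞`, the co-induced system is null iff the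
`H`-system is null. -/
theorem coinduced_null_iff_null
    {G X : Type*} [Group G] [Countable G] [Infinite G] [MetricSpace X] [CompactSpace X]
    (H : Subgroup G) (hH : H.index ≠ 0) (α : ↥H → X → X) (hα : IsActionBy α)
    (s : CoInd.RQ H → G) (hs : CoInd.IsSection H s) :
    (∀ 𝔰 : ℕ → G, seqEnt (CoInd.coindAct H α s) 𝔰 = 0) ↔
      (∀ 𝔱 : ℕ → ↥H, seqEnt α 𝔱 = 0) := by
  have := CoInd.finite_RQ hH
  exact ⟨fun h _ => CoInd.seqEnt_eq_zero_of_coindAct hα.2.2 hs (h _),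
    fun h _ => CoInd.seqEnt_coindAct_eq_zero hα.2.2 hs fun _ => h _⟩
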